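/- arXiv:2604.15063 — 4 statements merged into one kernel-verified Lean document; each statement's English description precedes it below -/
import Mathlib

section
/- Under the attacked-network setup, fix a neuron index i and a sample index j such that ⟨w, x_j⟩ + b_i > 0 and r_j · g_i ≠ 0. Then the per-sample loss L_j, as a function of the i-th weight row and i-th bias, is differentiable at the evaluation point with gradient with respect to the weight row W_i equal to r_j · g_i · x_j and partial derivative with respect to b_i equal to r_j · g_i; consequently the input is exactly recovered as x_j = (∇_{W_i} L_j) / (∂ L_j / ∂ b_i). -/
open scoped RealInnerProductSpace BigOperators

noncomputable section

/-- Output of the attacked network: `F(W, b; x) = ∑ i, g i * max (⟪W i, x⟫ + b i) 0 + c`. -/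
def netF {d N : ℕ} (g : Fin N → ℝ) (c : ℝ)
    (W : Fin N → EuclideanSpace ℝ (Fin d)) (b : Fin N → ℝ)
    (x : EuclideanSpace ℝ (Fin d)) : ℝ :=
  (∑ i, g i * max (⟪W i, x⟫ + b i) 0) + c

/-- Residual `r j = ℓ j ′ (F(w, b; x j))`, evaluated at the point where all weight rows
equal `w`. -/
def sResidual {d B N : ℕ} (ℓ : Fin B → ℝ → ℝ) (g : Fin N → ℝ) (c : ℝ)
    (x : Fin B → EuclideanSpace ℝ (Fin d)) (w : EuclideanSpace ℝ (Fin d))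
    (b : Fin N → ℝ) (j : Fin B) : ℝ :=
  deriv (ℓ j) (netF g c (fun _ => w) b (x j))

/-- Isolate the contribution of neuron `i`. -/
lemma netF_isolate {d N : ℕ} (g : Fin N → ℝ) (c : ℝ)
    (W : Fin N → EuclideanSpace ℝ (Fin d)) (b : Fin N → ℝ)
    (x : EuclideanSpace ℝ (Fin d)) (i : Fin N) (Wi : EuclideanSpace ℝ (Fin d)) (t : ℝ) :
    netF g c (Function.update W i Wi) (Function.update b i t) x =
      g i * max (⟪Wi, x⟫ + t) 0 +
        ((∑ k ∈ Finset.univ.erase i, g k * max (⟪W k, x⟫ + b k) 0) + c) := by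
  unfold netF
  rw [← Finset.add_sum_erase _ _ (Finset.mem_univ i), Function.update_self,
    Function.update_self, add_assoc]
  congr 2
  refine Finset.sum_congr rfl fun k hk => ?_
  rw [Function.update_of_ne (Finset.ne_of_mem_erase hk),
    Function.update_of_ne (Finset.ne_of_mem_erase hk)]

/-- Derivative of the loss in the preactivation of an active neuron. -/
lemma hasDerivAt_preact (f : ℝ → ℝ) (hf : Differentiable ℝ f) (a K s : ℝ) (hs : 0 < s) :
    HasDerivAt (fun u : ℝ => f (a * max u 0 + K)) (deriv f (a * max s 0 + K) * a) s := by
  have h1 : HasDerivAt (fun u : ℝ => max u 0) 1 s := by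
    refine (hasDerivAt_id s).congr_of_eventuallyEq ?_
    filter_upwards [lt_mem_nhds hs] with u hu
    exact max_eq_left hu.le
  have h2 : HasDerivAt (fun u : ℝ => a * max u 0 + K) a s := by
    simpa using (h1.const_mul a).add_const K
  exact (hf _).hasDerivAt.comp s h2

/-- if sample `j` activates neuron `i` and `r j * g i ≠ 0`, then the per-sample
loss `L j` is differentiable at the evaluation point, its gradient w.r.t. the `i`-th weight
row is `(r j * g i) • x j`, its partial derivative w.r.t. `b i` is `r j * g i`, and hence
`x j` is recovered as the gradient divided by the bias partial derivative. -/
theorem single_sample_gradient_recovery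
    {d B N : ℕ}
    (x : Fin B → EuclideanSpace ℝ (Fin d)) (w : EuclideanSpace ℝ (Fin d))
    (b : Fin N → ℝ) (g : Fin N → ℝ) (c : ℝ)
    (hg : ∀ i, g i ≠ 0)
    (ℓ : Fin B → ℝ → ℝ) (hℓ : ∀ j, Differentiable ℝ (ℓ j))
    (hboundary : ∀ (i : Fin N) (j : Fin B), ⟪w, x j⟫ + b i ≠ 0)
    (i : Fin N) (j : Fin B)
    (hact : 0 < ⟪w, x j⟫ + b i)
    (hne : sResidual ℓ g c x w b j * g i ≠ 0) :
    HasGradientAt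
        (fun Wi : EuclideanSpace ℝ (Fin d) =>
          ℓ j (netF g c (Function.update (fun _ => w) i Wi) b (x j)))
        ((sResidual ℓ g c x w b j * g i) • x j) w ∧
      HasDerivAt
        (fun t : ℝ =>
          ℓ j (netF g c (fun _ => w) (Function.update b i t) (x j)))
        (sResidual ℓ g c x w b j * g i) (b i) ∧
      (sResidual ℓ g c x w b j * g i)⁻¹ •
          ((sResidual ℓ g c x w b j * g i) • x j) = x j := by
  have hF := netF_isolate g c (fun _ => w) b (x j) i
  set K := (∑ k ∈ Finset.univ.erase i, g k * max (⟪w, x j⟫ + b k) 0) + c with hK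
  have h0 := hF w (b i)
  have hw : Function.update (fun _ : Fin N => w) i w = fun _ => w :=
    Function.update_eq_self i (fun _ : Fin N => w)
  rw [hw, Function.update_eq_self] at h0
  have hd := hasDerivAt_preact (ℓ j) (hℓ j) (g i) K _ hact
  have hr : sResidual ℓ g c x w b j = deriv (ℓ j) (g i * max (⟪w, x j⟫ + b i) 0 + K) := by
    unfold sResidual
    rw [h0]
  rw [← hr] at hd
  refine ⟨?_, ?_, inv_smul_smul₀ hne _⟩
  · have e : (fun Wi : EuclideanSpace ℝ (Fin d) =>
          ℓ j (netF g c (Function.update (fun _ => w) i Wi) b (x j))) =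
        fun Wi => ℓ j (g i * max (⟪Wi, x j⟫ + b i) 0 + K) := by
      funext Wi
      have := hF Wi (b i)
      rw [Function.update_eq_self] at this
      rw [this]
    rw [e, hasGradientAt_iff_hasFDerivAt]
    have hl : HasFDerivAt (fun Wi : EuclideanSpace ℝ (Fin d) => ⟪Wi, x j⟫ + b i)
        (innerSL ℝ (x j)) w := by
      have := ((innerSL ℝ (x j)).hasFDerivAt (x := w)).add_const (b i)
      refine this.congr_of_eventuallyEq (Filter.Eventually.of_forall fun v => ?_)
      simp [real_inner_comm]
    refine (hd.comp_hasFDerivAt w hl).congr_fderiv ?_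
    ext v
    simp [inner_smul_left]
  · have e : (fun t : ℝ =>
          ℓ j (netF g c (fun _ => w) (Function.update b i t) (x j))) =
        fun t => ℓ j (g i * max (⟪w, x j⟫ + t) 0 + K) := by
      funext t
      have := hF w t
      rw [hw] at this
      rw [this]
    rw [e]
    exact HasDerivAt.comp_const_add (⟪w, x j⟫) (b i) hd

end
end

section
/- Under the attacked-network setup, fix a neuron index i and assume Σ_{j ∈ A_i} r_j ≠ 0. Then the observation o_i = (∇_{W_i} L) / (∂ L / ∂ b_i) satisfies o_i = Σ_{j ∈ A_i} α_j · x_j, where α_j = r_j / (Σ_{k ∈ A_i} r_k), and the coefficients sum to one: Σ_{j ∈ A_i} α_j = 1. In particular, the observation is an affine combination of exactly the inputs that activate neuron i. -/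
open scoped RealInnerProductSpace BigOperators

noncomputable section

/-- Batch loss `L(W, b) = (1/B) ∑ j, ℓ j (F(W, b; x j))`. -/
def batchLoss {d B N : ℕ} (ℓ : Fin B → ℝ → ℝ) (g : Fin N → ℝ) (c : ℝ)
    (x : Fin B → EuclideanSpace ℝ (Fin d))
    (W : Fin N → EuclideanSpace ℝ (Fin d)) (b : Fin N → ℝ) : ℝ :=
  (1 / (B : ℝ)) * ∑ j, ℓ j (netF g c W b (x j))

/-- Active set `A i = {j : ⟪w, x j⟫ + b i > 0}`. -/
def activeSet {d B N : ℕ} (x : Fin B → EuclideanSpace ℝ (Fin d))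
    (w : EuclideanSpace ℝ (Fin d)) (b : Fin N → ℝ) (i : Fin N) : Finset (Fin B) :=
  Finset.univ.filter fun j => 0 < ⟪w, x j⟫ + b i

/-- Gradient of the batch loss with respect to the `i`-th weight row, at the evaluation
point where all weight rows equal `w`. -/
def gradW {d B N : ℕ} (ℓ : Fin B → ℝ → ℝ) (g : Fin N → ℝ) (c : ℝ)
    (x : Fin B → EuclideanSpace ℝ (Fin d)) (w : EuclideanSpace ℝ (Fin d))
    (b : Fin N → ℝ) (i : Fin N) : EuclideanSpace ℝ (Fin d) :=
  gradient (fun Wi : EuclideanSpace ℝ (Fin d) =>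
    batchLoss ℓ g c x (Function.update (fun _ => w) i Wi) b) w

/-- Partial derivative of the batch loss with respect to the `i`-th bias, at the evaluation
point where all weight rows equal `w`. -/
def gradB {d B N : ℕ} (ℓ : Fin B → ℝ → ℝ) (g : Fin N → ℝ) (c : ℝ)
    (x : Fin B → EuclideanSpace ℝ (Fin d)) (w : EuclideanSpace ℝ (Fin d))
    (b : Fin N → ℝ) (i : Fin N) : ℝ :=
  deriv (fun t : ℝ => batchLoss ℓ g c x (fun _ => w) (Function.update b i t)) (b i)

lemma relu_hasDerivAt (s : ℝ) (hs : s ≠ 0) :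
    HasDerivAt (fun t : ℝ => max t 0) (if 0 < s then 1 else 0) s := by
  rcases lt_or_gt_of_ne hs with h | h
  · rw [if_neg (not_lt.2 h.le)]
    refine (hasDerivAt_const s (0 : ℝ)).congr_of_eventuallyEq ?_
    filter_upwards [Iio_mem_nhds h] with t ht
    exact max_eq_right (le_of_lt ht)
  · rw [if_pos h]
    refine (hasDerivAt_id s).congr_of_eventuallyEq ?_
    filter_upwards [Ioi_mem_nhds h] with t ht
    exact max_eq_left (le_of_lt ht)

lemma netF_split {d N : ℕ} (g : Fin N → ℝ) (c : ℝ)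
    (W W' : Fin N → EuclideanSpace ℝ (Fin d)) (b b' : Fin N → ℝ)
    (x : EuclideanSpace ℝ (Fin d)) (i : Fin N)
    (hW : ∀ k, k ≠ i → W' k = W k) (hb : ∀ k, k ≠ i → b' k = b k) :
    netF g c W' b' x = netF g c W b x +
      g i * (max (⟪W' i, x⟫ + b' i) 0 - max (⟪W i, x⟫ + b i) 0) := by
  unfold netF
  rw [← Finset.add_sum_erase _ _ (Finset.mem_univ i),
    ← Finset.add_sum_erase _ (fun k => g k * max (⟪W k, x⟫ + b k) 0) (Finset.mem_univ i)]
  have : ∑ k ∈ Finset.univ.erase i, g k * max (⟪W' k, x⟫ + b' k) 0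
      = ∑ k ∈ Finset.univ.erase i, g k * max (⟪W k, x⟫ + b k) 0 := by
    refine Finset.sum_congr rfl fun k hk => ?_
    rw [hW k (Finset.ne_of_mem_erase hk), hb k (Finset.ne_of_mem_erase hk)]
  rw [this]
  ring

lemma loss_hasDerivAt (f : ℝ → ℝ) (hf : Differentiable ℝ f) (F a s : ℝ) (hs : s ≠ 0) :
    HasDerivAt (fun t : ℝ => f (F + a * (max t 0 - max s 0)))
      (deriv f F * (a * (if 0 < s then 1 else 0))) s := by
  have h1 : HasDerivAt (fun t : ℝ => F + a * (max t 0 - max s 0))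
      (a * (if 0 < s then 1 else 0)) s :=
    (((relu_hasDerivAt s hs).sub_const _).const_mul a).const_add F
  have h2 : HasDerivAt f (deriv f F) (F + a * (max s 0 - max s 0)) := by
    simpa using (hf F).hasDerivAt
  exact h2.comp s h1

lemma gradB_eq {d B N : ℕ}
    (x : Fin B → EuclideanSpace ℝ (Fin d)) (w : EuclideanSpace ℝ (Fin d))
    (b : Fin N → ℝ) (g : Fin N → ℝ) (c : ℝ)
    (ℓ : Fin B → ℝ → ℝ) (hℓ : ∀ j, Differentiable ℝ (ℓ j))
    (hboundary : ∀ (i : Fin N) (j : Fin B), ⟪w, x j⟫ + b i ≠ 0) (i : Fin N) :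
    gradB ℓ g c x w b i =
      (1 / (B : ℝ) * g i) * ∑ j ∈ activeSet x w b i, sResidual ℓ g c x w b j := by
  unfold gradB
  have key : HasDerivAt
      (fun t : ℝ => batchLoss ℓ g c x (fun _ => w) (Function.update b i t))
      ((1 / (B : ℝ)) * ∑ j, sResidual ℓ g c x w b j *
        (g i * (if 0 < ⟪w, x j⟫ + b i then 1 else 0))) (b i) := by
    unfold batchLoss
    refine HasDerivAt.const_mul _ (HasDerivAt.fun_sum fun j _ => ?_)
    have e : (fun t : ℝ => ℓ j (netF g c (fun _ => w) (Function.update b i t) (x j))) =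
        fun t => ℓ j (netF g c (fun _ => w) b (x j) +
          g i * (max (⟪w, x j⟫ + t) 0 - max (⟪w, x j⟫ + b i) 0)) := by
      funext t
      rw [netF_split g c (fun _ => w) (fun _ => w) b (Function.update b i t) (x j) i
        (fun _ _ => rfl) (fun k hk => Function.update_of_ne hk _ _), Function.update_self]
    rw [e]
    have h := (loss_hasDerivAt (ℓ j) (hℓ j) (netF g c (fun _ => w) b (x j)) (g i) _
      (hboundary i j)).comp (b i) ((hasDerivAt_id (b i)).const_add ⟪w, x j⟫)
    rw [mul_one] at h
    exact h
  rw [key.deriv, activeSet, Finset.sum_filter, mul_assoc, Finset.mul_sum _ _ (g i)]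
  congr 1
  refine Finset.sum_congr rfl fun j _ => ?_
  split_ifs <;> ring

lemma gradW_eq {d B N : ℕ}
    (x : Fin B → EuclideanSpace ℝ (Fin d)) (w : EuclideanSpace ℝ (Fin d))
    (b : Fin N → ℝ) (g : Fin N → ℝ) (c : ℝ)
    (ℓ : Fin B → ℝ → ℝ) (hℓ : ∀ j, Differentiable ℝ (ℓ j))
    (hboundary : ∀ (i : Fin N) (j : Fin B), ⟪w, x j⟫ + b i ≠ 0) (i : Fin N) :
    gradW ℓ g c x w b i =
      (1 / (B : ℝ) * g i) • ∑ j ∈ activeSet x w b i, sResidual ℓ g c x w b j • x j := by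
  unfold gradW
  have key : HasFDerivAt
      (fun Wi : EuclideanSpace ℝ (Fin d) =>
        batchLoss ℓ g c x (Function.update (fun _ => w) i Wi) b)
      ((1 / (B : ℝ)) • ∑ j, (sResidual ℓ g c x w b j *
        (g i * (if 0 < ⟪w, x j⟫ + b i then 1 else 0))) • innerSL ℝ (x j)) w := by
    unfold batchLoss
    refine HasFDerivAt.const_mul (HasFDerivAt.fun_sum fun j _ => ?_) _
    have e : (fun Wi : EuclideanSpace ℝ (Fin d) =>
          ℓ j (netF g c (Function.update (fun _ => w) i Wi) b (x j))) =
        fun Wi => ℓ j (netF g c (fun _ => w) b (x j) +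
          g i * (max (⟪Wi, x j⟫ + b i) 0 - max (⟪w, x j⟫ + b i) 0)) := by
      funext Wi
      rw [netF_split g c (fun _ => w) (Function.update (fun _ => w) i Wi) b b (x j) i
        (fun k hk => Function.update_of_ne hk _ _) (fun _ _ => rfl), Function.update_self]
    rw [e]
    have hin : HasFDerivAt (fun Wi : EuclideanSpace ℝ (Fin d) => ⟪Wi, x j⟫ + b i)
        (innerSL ℝ (x j)) w := by
      have h0 := ((innerSL ℝ (x j)).hasFDerivAt (x := w)).add_const (b i)
      refine h0.congr_of_eventuallyEq (Filter.Eventually.of_forall fun Wi => ?_)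
      simp [real_inner_comm]
    have hfin := (loss_hasDerivAt (ℓ j) (hℓ j) (netF g c (fun _ => w) b (x j)) (g i) _
      (hboundary i j)).comp_hasFDerivAt w hin
    exact hfin
  refine HasGradientAt.gradient ?_
  rw [hasGradientAt_iff_hasFDerivAt]
  refine key.congr_fderiv ?_
  ext v
  simp only [activeSet, Finset.sum_filter, InnerProductSpace.toDual_apply_apply, inner_smul_left,
    sum_inner, ContinuousLinearMap.smul_apply, ContinuousLinearMap.sum_apply, innerSL_apply_apply,
    smul_eq_mul, mul_assoc, Finset.mul_sum, RCLike.conj_to_real]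
  refine Finset.sum_congr rfl fun j _ => ?_
  split_ifs
  · rw [inner_smul_left, RCLike.conj_to_real]
    ring
  · simp

/-- if `∑_{j ∈ A i} r j ≠ 0`, the observation
`o i = (∇_{W i} L) / (∂L/∂(b i))` is the affine combination
`∑_{j ∈ A i} (r j / ∑_{k ∈ A i} r k) • x j` of exactly the inputs activating neuron `i`,
and the coefficients sum to one. -/
theorem observation_affine_combination
    {d B N : ℕ}
    (x : Fin B → EuclideanSpace ℝ (Fin d)) (w : EuclideanSpace ℝ (Fin d))
    (b : Fin N → ℝ) (g : Fin N → ℝ) (c : ℝ)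
    (hg : ∀ i, g i ≠ 0)
    (ℓ : Fin B → ℝ → ℝ) (hℓ : ∀ j, Differentiable ℝ (ℓ j))
    (hboundary : ∀ (i : Fin N) (j : Fin B), ⟪w, x j⟫ + b i ≠ 0)
    (i : Fin N)
    (hsum : ∑ j ∈ activeSet x w b i, sResidual ℓ g c x w b j ≠ 0) :
    (gradB ℓ g c x w b i)⁻¹ • gradW ℓ g c x w b i =
        ∑ j ∈ activeSet x w b i,
          (sResidual ℓ g c x w b j /
            ∑ k ∈ activeSet x w b i, sResidual ℓ g c x w b k) • x j ∧
      ∑ j ∈ activeSet x w b i,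
        (sResidual ℓ g c x w b j /
          ∑ k ∈ activeSet x w b i, sResidual ℓ g c x w b k) = 1 := by
  have hB : (B : ℝ) ≠ 0 := by
    rintro h
    have h0 : B = 0 := by exact_mod_cast h
    subst h0
    apply hsum
    rw [Finset.eq_empty_of_isEmpty (activeSet x w b i), Finset.sum_empty]
  refine ⟨?_, ?_⟩
  · rw [gradB_eq x w b g c ℓ hℓ hboundary, gradW_eq x w b g c ℓ hℓ hboundary, smul_smul,
      Finset.smul_sum]
    refine Finset.sum_congr rfl fun j _ => ?_
    rw [smul_smul]
    congr 1
    have := hg i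
    field_simp
  · rw [← Finset.sum_div, div_self hsum]

end
end

section
/- Under the attacked-network setup, let i, i′ be two neuron indices with b_i < b_{i′}. Then the active sets are nested, A_i ⊆ A_{i′}, and the rescaled gradient differences cancel all samples activating both neurons: (1/g_{i′}) · ∇_{W_{i′}} L − (1/g_i) · ∇_{W_i} L = (1/B) · Σ_{j ∈ A_{i′} \ A_i} r_j · x_j (the slice vector), and (1/g_{i′}) · (∂ L / ∂ b_{i′}) − (1/g_i) · (∂ L / ∂ b_i) = (1/B) · Σ_{j ∈ A_{i′} \ A_i} r_j (the slice scalar). -/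
open scoped RealInnerProductSpace BigOperators

noncomputable section

theorem aux_netF_W {d N : ℕ} (g : Fin N → ℝ) (c : ℝ) (w v : EuclideanSpace ℝ (Fin d))
    (b : Fin N → ℝ) (x : EuclideanSpace ℝ (Fin d)) (i : Fin N) :
    netF g c (Function.update (fun _ => w) i v) b x =
      netF g c (fun _ => w) b x + g i * (max (⟪v, x⟫ + b i) 0 - max (⟪w, x⟫ + b i) 0) := by
  unfold netF
  beta_reduce
  rw [← Finset.add_sum_erase _ _ (Finset.mem_univ i),
    ← Finset.add_sum_erase _ (fun k => g k * max (⟪w, x⟫ + b k) 0) (Finset.mem_univ i)]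
  have : ∑ k ∈ Finset.univ.erase i,
      g k * max (⟪Function.update (fun _ => w) i v k, x⟫ + b k) 0 =
      ∑ k ∈ Finset.univ.erase i, g k * max (⟪w, x⟫ + b k) 0 := by
    refine Finset.sum_congr rfl fun k hk => ?_
    rw [Function.update_of_ne (Finset.ne_of_mem_erase hk)]
  rw [this, Function.update_self]
  ring

theorem aux_netF_b {d N : ℕ} (g : Fin N → ℝ) (c : ℝ) (w : EuclideanSpace ℝ (Fin d))
    (b : Fin N → ℝ) (t : ℝ) (x : EuclideanSpace ℝ (Fin d)) (i : Fin N) :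
    netF g c (fun _ => w) (Function.update b i t) x =
      netF g c (fun _ => w) b x + g i * (max (⟪w, x⟫ + t) 0 - max (⟪w, x⟫ + b i) 0) := by
  unfold netF
  beta_reduce
  rw [← Finset.add_sum_erase _ _ (Finset.mem_univ i),
    ← Finset.add_sum_erase _ (fun k => g k * max (⟪w, x⟫ + b k) 0) (Finset.mem_univ i)]
  have : ∑ k ∈ Finset.univ.erase i, g k * max (⟪w, x⟫ + Function.update b i t k) 0 =
      ∑ k ∈ Finset.univ.erase i, g k * max (⟪w, x⟫ + b k) 0 := by
    refine Finset.sum_congr rfl fun k hk => ?_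
    rw [Function.update_of_ne (Finset.ne_of_mem_erase hk)]
  rw [this, Function.update_self]
  ring

theorem aux_relu (z : ℝ) (hz : z ≠ 0) :
    HasDerivAt (fun t : ℝ => max t 0) (if 0 < z then 1 else 0) z := by
  rcases lt_or_gt_of_ne hz with h | h
  · rw [if_neg (not_lt.mpr h.le)]
    refine (hasDerivAt_const z (0 : ℝ)).congr_of_eventuallyEq ?_
    filter_upwards [gt_mem_nhds h] with t ht
    exact max_eq_right ht.le
  · rw [if_pos h]
    refine (hasDerivAt_id z).congr_of_eventuallyEq ?_
    filter_upwards [lt_mem_nhds h] with t ht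
    exact max_eq_left ht.le

theorem aux_sample (f : ℝ → ℝ) (hf : Differentiable ℝ f) (F a z : ℝ) (hz : z ≠ 0) :
    HasDerivAt (fun t : ℝ => f (F + a * (max t 0 - max z 0)))
      (a * (if 0 < z then deriv f F else 0)) z := by
  have h1 : HasDerivAt (fun t : ℝ => F + a * (max t 0 - max z 0))
      (a * (if 0 < z then 1 else 0)) z :=
    (((aux_relu z hz).sub_const _).const_mul a).const_add F
  have h2 : HasDerivAt f (deriv f F) (F + a * (max z 0 - max z 0)) := by
    simpa using (hf F).hasDerivAt
  refine (h2.comp z h1).congr_deriv ?_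
  split_ifs <;> ring

theorem aux_gradB {d B N : ℕ}
    (x : Fin B → EuclideanSpace ℝ (Fin d)) (w : EuclideanSpace ℝ (Fin d))
    (b : Fin N → ℝ) (g : Fin N → ℝ) (c : ℝ)
    (ℓ : Fin B → ℝ → ℝ) (hℓ : ∀ j, Differentiable ℝ (ℓ j))
    (hboundary : ∀ (i : Fin N) (j : Fin B), ⟪w, x j⟫ + b i ≠ 0) (i : Fin N) :
    gradB ℓ g c x w b i = g i * ((1 / (B : ℝ)) *
      ∑ j ∈ activeSet x w b i, sResidual ℓ g c x w b j) := by
  unfold gradB batchLoss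
  simp only [aux_netF_b]
  have h : ∀ j ∈ (Finset.univ : Finset (Fin B)), HasDerivAt (fun t : ℝ =>
      ℓ j (netF g c (fun _ => w) b (x j) +
        g i * (max (⟪w, x j⟫ + t) 0 - max (⟪w, x j⟫ + b i) 0)))
      (g i * (if 0 < ⟪w, x j⟫ + b i then sResidual ℓ g c x w b j else 0)) (b i) := by
    intro j _
    have := (aux_sample (ℓ j) (hℓ j) (netF g c (fun _ => w) b (x j)) (g i) _
      (hboundary i j)).comp (b i) ((hasDerivAt_id (b i)).const_add ⟪w, x j⟫)
    rw [mul_one] at this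
    exact this
  have h2 := (HasDerivAt.fun_sum h).const_mul (1 / (B : ℝ))
  rw [h2.deriv, activeSet, Finset.sum_filter, ← Finset.mul_sum]
  ring

theorem aux_gradW {d B N : ℕ}
    (x : Fin B → EuclideanSpace ℝ (Fin d)) (w : EuclideanSpace ℝ (Fin d))
    (b : Fin N → ℝ) (g : Fin N → ℝ) (c : ℝ)
    (ℓ : Fin B → ℝ → ℝ) (hℓ : ∀ j, Differentiable ℝ (ℓ j))
    (hboundary : ∀ (i : Fin N) (j : Fin B), ⟪w, x j⟫ + b i ≠ 0) (i : Fin N) :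
    gradW ℓ g c x w b i = g i • ((1 / (B : ℝ)) •
      ∑ j ∈ activeSet x w b i, sResidual ℓ g c x w b j • x j) := by
  unfold gradW batchLoss
  simp only [aux_netF_W]
  apply HasGradientAt.gradient
  rw [hasGradientAt_iff_hasFDerivAt]
  have h : ∀ j ∈ (Finset.univ : Finset (Fin B)), HasFDerivAt
      (fun v : EuclideanSpace ℝ (Fin d) =>
      ℓ j (netF g c (fun _ => w) b (x j) +
        g i * (max (⟪v, x j⟫ + b i) 0 - max (⟪w, x j⟫ + b i) 0)))
      ((g i * (if 0 < ⟪w, x j⟫ + b i then sResidual ℓ g c x w b j else 0)) •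
        innerSL ℝ (x j)) w := by
    intro j _
    have hl : HasFDerivAt (fun v : EuclideanSpace ℝ (Fin d) => ⟪v, x j⟫ + b i)
        (innerSL ℝ (x j)) w := by
      have := ((innerSL ℝ (x j)).hasFDerivAt (x := w)).add_const (b i)
      refine this.congr_of_eventuallyEq (Filter.Eventually.of_forall fun v => ?_)
      simp [real_inner_comm]
    have := (aux_sample (ℓ j) (hℓ j) (netF g c (fun _ => w) b (x j)) (g i) _
      (hboundary i j)).comp_hasFDerivAt w hl
    exact this
  have h2 := (HasFDerivAt.fun_sum h).const_mul (1 / (B : ℝ))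
  refine h2.congr_fderiv ?_
  rw [activeSet, Finset.sum_filter]
  ext v
  simp only [InnerProductSpace.toDual_apply_apply, inner_smul_left, sum_inner,
    ContinuousLinearMap.smul_apply, ContinuousLinearMap.sum_apply, innerSL_apply_apply,
    smul_eq_mul, Finset.mul_sum]
  refine Finset.sum_congr rfl fun j _ => ?_
  split_ifs
  · simp [inner_smul_left]; ring
  · simp

/-- for two neurons with `b i < b i'`, the active sets are nested
(`A i ⊆ A i'`), and the rescaled gradient differences cancel all samples activating both
neurons, leaving exactly the samples in the slice `A i' \ A i`. -/
theorem slice_vector_decomposition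
    {d B N : ℕ}
    (x : Fin B → EuclideanSpace ℝ (Fin d)) (w : EuclideanSpace ℝ (Fin d))
    (b : Fin N → ℝ) (g : Fin N → ℝ) (c : ℝ)
    (hg : ∀ i, g i ≠ 0)
    (ℓ : Fin B → ℝ → ℝ) (hℓ : ∀ j, Differentiable ℝ (ℓ j))
    (hboundary : ∀ (i : Fin N) (j : Fin B), ⟪w, x j⟫ + b i ≠ 0)
    (i i' : Fin N) (hbb : b i < b i') :
    activeSet x w b i ⊆ activeSet x w b i' ∧
      (g i')⁻¹ • gradW ℓ g c x w b i' - (g i)⁻¹ • gradW ℓ g c x w b i =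
        (1 / (B : ℝ)) •
          ∑ j ∈ activeSet x w b i' \ activeSet x w b i,
            sResidual ℓ g c x w b j • x j ∧
      (g i')⁻¹ * gradB ℓ g c x w b i' - (g i)⁻¹ * gradB ℓ g c x w b i =
        (1 / (B : ℝ)) *
          ∑ j ∈ activeSet x w b i' \ activeSet x w b i,
            sResidual ℓ g c x w b j := by
  have hsub : activeSet x w b i ⊆ activeSet x w b i' := by
    intro j hj
    simp only [activeSet, Finset.mem_filter, Finset.mem_univ, true_and] at hj ⊢
    linarith
  refine ⟨hsub, ?_, ?_⟩
  · rw [aux_gradW x w b g c ℓ hℓ hboundary, aux_gradW x w b g c ℓ hℓ hboundary,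
      inv_smul_smul₀ (hg i'), inv_smul_smul₀ (hg i), ← smul_sub,
      ← Finset.sum_sdiff hsub, add_sub_cancel_right]
  · rw [aux_gradB x w b g c ℓ hℓ hboundary, aux_gradB x w b g c ℓ hℓ hboundary,
      inv_mul_cancel_left₀ (hg i'), inv_mul_cancel_left₀ (hg i), ← mul_sub,
      ← Finset.sum_sdiff hsub, add_sub_cancel_right]

end
end

section
/- Collision implies span escape (converse direction of Proposition 4.1, deterministic core): let x_1, …, x_m ∈ ℝ^d be linearly independent, let G_1, …, G_q be pairwise disjoint subsets of {1,…,m} whose union is {1,…,m}, let β_1, …, β_m be real numbers, and let γ_1, …, γ_m be nonzero real numbers. Define s = Σ_{j=1}^m β_j x_j and v_r = Σ_{j ∈ G_r} γ_j x_j. If some G_r contains two distinct indices j, k with β_j · γ_k ≠ β_k · γ_j (i.e., the coefficient ratios across the two rounds differ), then s ∉ span{v_1, …, v_q}. -/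
open scoped BigOperators

/-- collision implies span escape. With `x 1, …, x m` linearly independent,
`G 1, …, G q` a partition of the index set, `s = ∑ j, β j • x j` and
`v r = ∑ j ∈ G r, γ j • x j` (with all `γ j ≠ 0`), if some block `G r` contains two
distinct indices `j ≠ k` with `β j * γ k ≠ β k * γ j`, then `s` is not in the span of
the `v r`. -/
theorem collision_implies_span_escape
    {d m q : ℕ}
    (x : Fin m → EuclideanSpace ℝ (Fin d))
    (hx : LinearIndependent ℝ x)
    (G : Fin q → Finset (Fin m))
    (hdisj : ∀ r₁ r₂ : Fin q, r₁ ≠ r₂ → Disjoint (G r₁) (G r₂))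
    (hcover : ∀ j : Fin m, ∃ r : Fin q, j ∈ G r)
    (β : Fin m → ℝ) (γ : Fin m → ℝ) (hγ : ∀ j, γ j ≠ 0)
    (r : Fin q) (j k : Fin m) (hj : j ∈ G r) (hk : k ∈ G r) (hjk : j ≠ k)
    (hratio : β j * γ k ≠ β k * γ j) :
    (∑ j, β j • x j) ∉
      Submodule.span ℝ (Set.range fun r : Fin q => ∑ j ∈ G r, γ j • x j) := by
  intro hmem
  obtain ⟨c, hc⟩ := (Submodule.mem_span_range_iff_exists_fun ℝ).1 hmem
  have h1 : ∑ i, (∑ t, c t * (if i ∈ G t then γ i else 0)) • x i = ∑ i, β i • x i := by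
    rw [← hc]
    simp only [Finset.sum_smul, Finset.smul_sum]
    rw [Finset.sum_comm]
    refine Finset.sum_congr rfl fun t _ => ?_
    rw [← Finset.sum_subset (Finset.subset_univ (G t))]
    · refine Finset.sum_congr rfl fun i hi => ?_
      rw [if_pos hi, mul_smul]
    · intro i _ hi
      rw [if_neg hi, mul_zero, zero_smul]
  have h2 : ∀ i, ∑ t, c t * (if i ∈ G t then γ i else 0) = β i := by
    intro i
    have h3 := Fintype.linearIndependent_iff.1 hx
      (fun i => (∑ t, c t * (if i ∈ G t then γ i else 0)) - β i)
      (by simp only [sub_smul, Finset.sum_sub_distrib, h1, sub_self]) i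
    exact sub_eq_zero.1 h3
  have h4 : ∀ i ∈ G r, β i = c r * γ i := by
    intro i hi
    rw [← h2 i, Finset.sum_eq_single r]
    · rw [if_pos hi]
    · intro t _ htr
      rw [if_neg (fun h => Finset.disjoint_left.1 (hdisj t r htr) h hi), mul_zero]
    · intro h
      exact absurd (Finset.mem_univ r) h
  apply hratio
  rw [h4 j hj, h4 k hk]
  ring
end
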